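/- arXiv:2207.06098 — 6 statements merged into one kernel-verified Lean document; each statement's English description precedes it below -/
import Mathlib

section
/- Assume ρ > 0, that W^y is diagonal with nonnegative diagonal entries, and that W^{Δu} is diagonal with strictly positive diagonal entries. Then the scaled augmented Lagrangian ℓ, viewed as a function of the decision variables (y_1,…,y_T, u_0,…,u_{T−1}, Δu_0,…,Δu_{T−1}) ∈ ℝ^{T·ny} × ℝ^{T·nu} × ℝ^{T·nu} with the multipliers λ_t, γ_t, the references r_t, and the past data held fixed, is strictly convex on the whole space. In particular, the augmented-Lagrangian subproblem of minimizing ℓ over any nonempty convex set of decision variables has at most one minimizer. -/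
open Matrix

/-- ARX residual `res_t(Y,U) = Σ_{i=1}^{na} A(i) y_{t-i} + Σ_{i=1}^{nb} B(i) u_{t-i} - y_t`. -/
noncomputable def arxRes (na nb ny nu : ℕ) (A : ℕ → Matrix (Fin ny) (Fin ny) ℝ)
    (B : ℕ → Matrix (Fin ny) (Fin nu) ℝ)
    (Y : ℤ → Fin ny → ℝ) (U : ℤ → Fin nu → ℝ) (t : ℤ) : Fin ny → ℝ :=
  (∑ i ∈ Finset.Icc 1 na, A i *ᵥ Y (t - i)) +
    (∑ i ∈ Finset.Icc 1 nb, B i *ᵥ U (t - i)) - Y t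

/-- Increment residual `d_t(U,ΔU) = u_{t-2} + Δu_{t-1} - u_{t-1}`. -/
noncomputable def incRes (nu : ℕ) (U ΔU : ℤ → Fin nu → ℝ) (t : ℤ) : Fin nu → ℝ :=
  U (t - 2) + ΔU (t - 1) - U (t - 1)

/-- Scaled augmented Lagrangian `ℓ(Y,U,ΔU)` of the ARX-based MPC problem. -/
noncomputable def augLag (T na nb ny nu : ℕ)
    (A : ℕ → Matrix (Fin ny) (Fin ny) ℝ) (B : ℕ → Matrix (Fin ny) (Fin nu) ℝ)
    (ρ : ℝ) (Wy : Matrix (Fin ny) (Fin ny) ℝ) (Wd : Matrix (Fin nu) (Fin nu) ℝ)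
    (r lam : ℤ → Fin ny → ℝ) (gam : ℤ → Fin nu → ℝ)
    (Y : ℤ → Fin ny → ℝ) (U ΔU : ℤ → Fin nu → ℝ) : ℝ :=
  (1 / (2 * ρ)) * ∑ t ∈ Finset.Icc (1 : ℤ) T,
      ((Y t - r t) ⬝ᵥ (Wy *ᵥ (Y t - r t)) + ΔU (t - 1) ⬝ᵥ (Wd *ᵥ ΔU (t - 1)))
    + ∑ t ∈ Finset.Icc (1 : ℤ) T, lam t ⬝ᵥ arxRes na nb ny nu A B Y U t
    + ∑ t ∈ Finset.Icc (1 : ℤ) T, gam t ⬝ᵥ incRes nu U ΔU t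
    + (1 / 2) * ∑ t ∈ Finset.Icc (1 : ℤ) T,
        arxRes na nb ny nu A B Y U t ⬝ᵥ arxRes na nb ny nu A B Y U t
    + (1 / 2) * ∑ t ∈ Finset.Icc (1 : ℤ) T, incRes nu U ΔU t ⬝ᵥ incRes nu U ΔU t

theorem dotProduct_mulVec_convexComb {n : ℕ} (W : Matrix (Fin n) (Fin n) ℝ) (x y : Fin n → ℝ)
    {a b : ℝ} (hab : a + b = 1) :
    (a • x + b • y) ⬝ᵥ (W *ᵥ (a • x + b • y)) =
      a * (x ⬝ᵥ (W *ᵥ x)) + b * (y ⬝ᵥ (W *ᵥ y)) - a * b * ((x - y) ⬝ᵥ (W *ᵥ (x - y))) := by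
  obtain rfl : b = 1 - a := by linarith
  simp only [mulVec_add, mulVec_sub, mulVec_smul, add_dotProduct, dotProduct_add, sub_dotProduct,
    dotProduct_sub, smul_dotProduct, dotProduct_smul, smul_eq_mul]
  ring

theorem dotProduct_self_convexComb {n : ℕ} (x y : Fin n → ℝ) {a b : ℝ} (hab : a + b = 1) :
    (a • x + b • y) ⬝ᵥ (a • x + b • y) =
      a * (x ⬝ᵥ x) + b * (y ⬝ᵥ y) - a * b * ((x - y) ⬝ᵥ (x - y)) := by
  simpa using dotProduct_mulVec_convexComb 1 x y hab

theorem Matrix.IsDiag.dotProduct_mulVec_self {n : ℕ} {W : Matrix (Fin n) (Fin n) ℝ}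
    (hW : W.IsDiag) (x : Fin n → ℝ) : x ⬝ᵥ (W *ᵥ x) = ∑ i, W i i * x i ^ 2 := by
  rw [← hW.diagonal_diag]
  simp only [dotProduct, mulVec_diagonal, diagonal_apply_eq, diag_apply]
  exact Finset.sum_congr rfl fun i _ => by ring

theorem Matrix.IsDiag.dotProduct_mulVec_self_nonneg {n : ℕ} {W : Matrix (Fin n) (Fin n) ℝ}
    (hW : W.IsDiag) (hW0 : ∀ i, 0 ≤ W i i) (x : Fin n → ℝ) : 0 ≤ x ⬝ᵥ (W *ᵥ x) := by
  rw [hW.dotProduct_mulVec_self]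
  exact Finset.sum_nonneg fun i _ => mul_nonneg (hW0 i) (sq_nonneg _)

theorem Matrix.IsDiag.eq_zero_of_dotProduct_mulVec_self {n : ℕ} {W : Matrix (Fin n) (Fin n) ℝ}
    (hW : W.IsDiag) (hW0 : ∀ i, 0 < W i i) {x : Fin n → ℝ} (h : x ⬝ᵥ (W *ᵥ x) = 0) : x = 0 := by
  rw [hW.dotProduct_mulVec_self,
    Finset.sum_eq_zero_iff_of_nonneg fun i _ => mul_nonneg (hW0 i).le (sq_nonneg _)] at h
  funext i
  simpa [(hW0 i).ne'] using h i (Finset.mem_univ i)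

theorem arxRes_add (na nb ny nu : ℕ) (A : ℕ → Matrix (Fin ny) (Fin ny) ℝ)
    (B : ℕ → Matrix (Fin ny) (Fin nu) ℝ) (Y Y' : ℤ → Fin ny → ℝ) (U U' : ℤ → Fin nu → ℝ) (t : ℤ) :
    arxRes na nb ny nu A B (Y + Y') (U + U') t =
      arxRes na nb ny nu A B Y U t + arxRes na nb ny nu A B Y' U' t := by
  simp only [arxRes, Pi.add_apply, mulVec_add, Finset.sum_add_distrib]
  abel

theorem arxRes_smul (na nb ny nu : ℕ) (A : ℕ → Matrix (Fin ny) (Fin ny) ℝ)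
    (B : ℕ → Matrix (Fin ny) (Fin nu) ℝ) (c : ℝ) (Y : ℤ → Fin ny → ℝ) (U : ℤ → Fin nu → ℝ) (t : ℤ) :
    arxRes na nb ny nu A B (c • Y) (c • U) t = c • arxRes na nb ny nu A B Y U t := by
  simp only [arxRes, Pi.smul_apply, mulVec_smul, smul_sub, smul_add, Finset.smul_sum]

theorem arxRes_sub (na nb ny nu : ℕ) (A : ℕ → Matrix (Fin ny) (Fin ny) ℝ)
    (B : ℕ → Matrix (Fin ny) (Fin nu) ℝ) (Y Y' : ℤ → Fin ny → ℝ) (U U' : ℤ → Fin nu → ℝ) (t : ℤ) :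
    arxRes na nb ny nu A B (Y - Y') (U - U') t =
      arxRes na nb ny nu A B Y U t - arxRes na nb ny nu A B Y' U' t := by
  simp only [arxRes, Pi.sub_apply, mulVec_sub, Finset.sum_sub_distrib]
  abel

theorem incRes_add (nu : ℕ) (U U' V V' : ℤ → Fin nu → ℝ) (t : ℤ) :
    incRes nu (U + U') (V + V') t = incRes nu U V t + incRes nu U' V' t := by
  simp only [incRes, Pi.add_apply]
  abel

theorem incRes_smul (nu : ℕ) (c : ℝ) (U V : ℤ → Fin nu → ℝ) (t : ℤ) :
    incRes nu (c • U) (c • V) t = c • incRes nu U V t := by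
  simp only [incRes, Pi.smul_apply, smul_sub, smul_add]

theorem incRes_sub (nu : ℕ) (U U' V V' : ℤ → Fin nu → ℝ) (t : ℤ) :
    incRes nu (U - U') (V - V') t = incRes nu U V t - incRes nu U' V' t := by
  simp only [incRes, Pi.sub_apply]
  abel

/-- The convexity defect of the augmented Lagrangian is its purely quadratic part, i.e. the
augmented Lagrangian with zero references and multipliers, at the difference of the arguments. -/
theorem augLag_convexComb (T na nb ny nu : ℕ)
    (A : ℕ → Matrix (Fin ny) (Fin ny) ℝ) (B : ℕ → Matrix (Fin ny) (Fin nu) ℝ)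
    (ρ : ℝ) (Wy : Matrix (Fin ny) (Fin ny) ℝ) (Wd : Matrix (Fin nu) (Fin nu) ℝ)
    (r lam : ℤ → Fin ny → ℝ) (gam : ℤ → Fin nu → ℝ)
    (Y Y' : ℤ → Fin ny → ℝ) (U U' V V' : ℤ → Fin nu → ℝ) {a b : ℝ} (hab : a + b = 1) :
    augLag T na nb ny nu A B ρ Wy Wd r lam gam (a • Y + b • Y') (a • U + b • U') (a • V + b • V') =
      a * augLag T na nb ny nu A B ρ Wy Wd r lam gam Y U V +
        b * augLag T na nb ny nu A B ρ Wy Wd r lam gam Y' U' V' -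
        a * b * augLag T na nb ny nu A B ρ Wy Wd 0 0 0 (Y - Y') (U - U') (V - V') := by
  have hr : ∀ t, a • Y t + b • Y' t - r t = a • (Y t - r t) + b • (Y' t - r t) := by
    intro t
    obtain rfl : b = 1 - a := by linarith
    module
  simp only [augLag, hr, arxRes_add, arxRes_smul, arxRes_sub, incRes_add, incRes_smul, incRes_sub,
    Pi.add_apply, Pi.smul_apply, Pi.sub_apply, Pi.zero_apply, sub_zero, zero_dotProduct,
    dotProduct_mulVec_convexComb _ _ _ hab, dotProduct_self_convexComb _ _ hab, dotProduct_add,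
    dotProduct_smul, smul_eq_mul, Finset.sum_add_distrib, Finset.sum_sub_distrib,
    ← Finset.mul_sum, Finset.sum_const_zero, sub_sub_sub_cancel_right]
  ring

section Homogeneous

variable {T na nb ny nu : ℕ} {A : ℕ → Matrix (Fin ny) (Fin ny) ℝ}
  {B : ℕ → Matrix (Fin ny) (Fin nu) ℝ} {Y : ℤ → Fin ny → ℝ} {U V : ℤ → Fin nu → ℝ}

theorem input_eq_zero_of_incRes_eq_zero (hU : ∀ t < 0, U t = 0)
    (hV : ∀ t ∈ Finset.Icc (1 : ℤ) T, V (t - 1) = 0)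
    (hd : ∀ t ∈ Finset.Icc (1 : ℤ) T, incRes nu U V t = 0) : ∀ t < (T : ℤ), U t = 0 := by
  have key : ∀ n : ℕ, n ≤ T → U ((n : ℤ) - 1) = 0 := by
    intro n
    induction n with
    | zero => exact fun _ => hU _ (by norm_num)
    | succ n ih =>
      intro hn
      have hmem : ((n + 1 : ℕ) : ℤ) ∈ Finset.Icc (1 : ℤ) T := by
        rw [Finset.mem_Icc]; omega
      have h := hd _ hmem
      rw [incRes, hV _ hmem, show ((n + 1 : ℕ) : ℤ) - 2 = (n : ℤ) - 1 by push_cast; ring,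
        ih (by omega)] at h
      simpa using h
  intro t ht
  rcases lt_or_ge t 0 with h | h
  · exact hU t h
  · have := key (t + 1).toNat (by omega)
    rwa [show (((t + 1).toNat : ℕ) : ℤ) - 1 = t by omega] at this

theorem output_eq_zero_of_arxRes_eq_zero (hY : ∀ t ≤ 0, Y t = 0)
    (hU : ∀ t < (T : ℤ), U t = 0)
    (hres : ∀ t ∈ Finset.Icc (1 : ℤ) T, arxRes na nb ny nu A B Y U t = 0) :
    ∀ t ≤ (T : ℤ), Y t = 0 := by
  have key : ∀ n : ℕ, n ≤ T → ∀ t ≤ (n : ℤ), Y t = 0 := by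
    intro n
    induction n with
    | zero => exact fun _ t ht => hY t (by simpa using ht)
    | succ n ih =>
      intro hn t ht
      rcases eq_or_lt_of_le ht with rfl | ht
      · have h := hres ((n + 1 : ℕ) : ℤ) (by rw [Finset.mem_Icc]; omega)
        have hA : ∑ i ∈ Finset.Icc 1 na, A i *ᵥ Y (((n + 1 : ℕ) : ℤ) - i) = 0 :=
          Finset.sum_eq_zero fun i hi => by
            rw [Finset.mem_Icc] at hi
            rw [ih (by omega) _ (by omega), mulVec_zero]
        have hB : ∑ i ∈ Finset.Icc 1 nb, B i *ᵥ U (((n + 1 : ℕ) : ℤ) - i) = 0 :=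
          Finset.sum_eq_zero fun i hi => by
            rw [Finset.mem_Icc] at hi
            rw [hU _ (by omega), mulVec_zero]
        rw [arxRes, hA, hB] at h
        simpa using h
      · exact ih (by omega) t (by omega)
  exact key T le_rfl

variable {ρ : ℝ} {Wy : Matrix (Fin ny) (Fin ny) ℝ} {Wd : Matrix (Fin nu) (Fin nu) ℝ}

/-- With zero references and multipliers and zero past data, the augmented Lagrangian vanishes
only at the zero trajectory. -/
theorem eq_zero_of_augLag_nonpos (hρ : 0 < ρ) (hWy : Wy.IsDiag) (hWy0 : ∀ i, 0 ≤ Wy i i)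
    (hWd : Wd.IsDiag) (hWd0 : ∀ i, 0 < Wd i i)
    (hY : ∀ t ≤ 0, Y t = 0) (hU : ∀ t < 0, U t = 0)
    (h : augLag T na nb ny nu A B ρ Wy Wd 0 0 0 Y U V ≤ 0) :
    (∀ t ≤ (T : ℤ), Y t = 0) ∧ (∀ t < (T : ℤ), U t = 0) ∧
      ∀ t ∈ Finset.Icc (1 : ℤ) T, V (t - 1) = 0 := by
  have hy : ∀ t ∈ Finset.Icc (1 : ℤ) T, 0 ≤ Y t ⬝ᵥ (Wy *ᵥ Y t) := fun t _ =>
    hWy.dotProduct_mulVec_self_nonneg hWy0 _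
  have hv : ∀ t ∈ Finset.Icc (1 : ℤ) T, 0 ≤ V (t - 1) ⬝ᵥ (Wd *ᵥ V (t - 1)) := fun t _ =>
    hWd.dotProduct_mulVec_self_nonneg (fun i => (hWd0 i).le) _
  have hr : ∀ t ∈ Finset.Icc (1 : ℤ) T,
      0 ≤ arxRes na nb ny nu A B Y U t ⬝ᵥ arxRes na nb ny nu A B Y U t := fun t _ =>
    dotProduct_self_star_nonneg _
  have hd : ∀ t ∈ Finset.Icc (1 : ℤ) T, 0 ≤ incRes nu U V t ⬝ᵥ incRes nu U V t := fun t _ =>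
    dotProduct_self_star_nonneg _
  have hρ' : 0 < 1 / (2 * ρ) := by positivity
  simp only [augLag, Pi.zero_apply, sub_zero, zero_dotProduct, Finset.sum_const_zero, add_zero,
    Finset.sum_add_distrib, mul_add] at h
  have sy := mul_nonneg hρ'.le (Finset.sum_nonneg hy)
  have sv := mul_nonneg hρ'.le (Finset.sum_nonneg hv)
  have sr := Finset.sum_nonneg hr
  have sd := Finset.sum_nonneg hd
  have hv0 := (mul_eq_zero.mp (le_antisymm (by linarith) sv)).resolve_left hρ'.ne'
  have hr0 := le_antisymm (by linarith) sr
  have hd0 := le_antisymm (by linarith) sd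
  rw [Finset.sum_eq_zero_iff_of_nonneg hv] at hv0
  rw [Finset.sum_eq_zero_iff_of_nonneg hr] at hr0
  rw [Finset.sum_eq_zero_iff_of_nonneg hd] at hd0
  have hV : ∀ t ∈ Finset.Icc (1 : ℤ) T, V (t - 1) = 0 := fun t ht =>
    hWd.eq_zero_of_dotProduct_mulVec_self hWd0 (hv0 t ht)
  have hU' := input_eq_zero_of_incRes_eq_zero hU hV fun t ht =>
    dotProduct_self_eq_zero.mp (hd0 t ht)
  exact ⟨output_eq_zero_of_arxRes_eq_zero hY hU' fun t ht =>
    dotProduct_self_eq_zero.mp (hr0 t ht), hU', hV⟩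

end Homogeneous

theorem dite_convexComb {E : Type*} [AddCommGroup E] [Module ℝ E] {c : Prop} [Decidable c]
    (f g : c → E) (e : E) {a b : ℝ} (hab : a + b = 1) :
    (if h : c then a • f h + b • g h else e) =
      a • (if h : c then f h else e) + b • (if h : c then g h else e) := by
  split_ifs
  · rfl
  · rw [← add_smul, hab, one_smul]

/-- With `ρ > 0`, `W^y` diagonal with nonnegative diagonal and `W^{Δu}` diagonal with
strictly positive diagonal, the scaled augmented Lagrangian, viewed as a function of the
decision variables `(y_1,…,y_T, u_0,…,u_{T-1}, Δu_0,…,Δu_{T-1})` with multipliers,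
references and past data held fixed, is strictly convex on the whole space; in particular
its minimization over any nonempty convex set has at most one minimizer. -/
theorem augLag_strictConvexOn (T na nb ny nu : ℕ)
    (hT : 1 ≤ T) (hna : 1 ≤ na) (hnb : 1 ≤ nb) (hny : 1 ≤ ny) (hnu : 1 ≤ nu)
    (A : ℕ → Matrix (Fin ny) (Fin ny) ℝ) (B : ℕ → Matrix (Fin ny) (Fin nu) ℝ)
    (ρ : ℝ) (hρ : 0 < ρ)
    (Wy : Matrix (Fin ny) (Fin ny) ℝ) (Wd : Matrix (Fin nu) (Fin nu) ℝ)
    (hWy : Wy.IsDiag) (hWy0 : ∀ i, 0 ≤ Wy i i)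
    (hWd : Wd.IsDiag) (hWd0 : ∀ i, 0 < Wd i i)
    (r lam : ℤ → Fin ny → ℝ) (gam : ℤ → Fin nu → ℝ)
    (ypast : ℤ → Fin ny → ℝ) (upast : ℤ → Fin nu → ℝ) :
    let L : (Fin T → Fin ny → ℝ) × (Fin T → Fin nu → ℝ) × (Fin T → Fin nu → ℝ) → ℝ :=
      fun p =>
        augLag T na nb ny nu A B ρ Wy Wd r lam gam
          (fun t : ℤ => if ht : 1 ≤ t ∧ t ≤ T then p.1 ⟨(t - 1).toNat, by omega⟩ else ypast t)
          (fun t : ℤ => if ht : 0 ≤ t ∧ t < T then p.2.1 ⟨t.toNat, by omega⟩ else upast t)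
          (fun t : ℤ => if ht : 0 ≤ t ∧ t < T then p.2.2 ⟨t.toNat, by omega⟩ else 0)
    StrictConvexOn ℝ Set.univ L ∧
      ∀ S : Set ((Fin T → Fin ny → ℝ) × (Fin T → Fin nu → ℝ) × (Fin T → Fin nu → ℝ)),
        S.Nonempty → Convex ℝ S →
          ∀ p ∈ S, ∀ q ∈ S,
            (∀ z ∈ S, L p ≤ L z) → (∀ z ∈ S, L q ≤ L z) → p = q := by
  intro L
  have hL : StrictConvexOn ℝ Set.univ L := by
    refine ⟨convex_univ, fun p _ q _ hpq a b ha hb hab => ?_⟩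
    let eY : (Fin T → Fin ny → ℝ) → ℤ → Fin ny → ℝ := fun y t =>
      if ht : 1 ≤ t ∧ t ≤ T then y ⟨(t - 1).toNat, by omega⟩ else ypast t
    let eU : (ℤ → Fin nu → ℝ) → (Fin T → Fin nu → ℝ) → ℤ → Fin nu → ℝ := fun past u t =>
      if ht : 0 ≤ t ∧ t < T then u ⟨t.toNat, by omega⟩ else past t
    have hY : eY (a • p + b • q).1 = a • eY p.1 + b • eY q.1 :=
      funext fun t => dite_convexComb _ _ _ hab
    have hU : eU upast (a • p + b • q).2.1 = a • eU upast p.2.1 + b • eU upast q.2.1 :=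
      funext fun t => dite_convexComb _ _ _ hab
    have hV : eU 0 (a • p + b • q).2.2 = a • eU 0 p.2.2 + b • eU 0 q.2.2 :=
      funext fun t => dite_convexComb _ _ _ hab
    have hLe : ∀ p, L p = augLag T na nb ny nu A B ρ Wy Wd r lam gam
        (eY p.1) (eU upast p.2.1) (eU 0 p.2.2) := fun _ => rfl
    rw [hLe, hLe, hLe, hY, hU, hV, augLag_convexComb (hab := hab),
      smul_eq_mul, smul_eq_mul]
    refine sub_lt_self _ (mul_pos (mul_pos ha hb) (not_le.mp fun hle => hpq ?_))
    obtain ⟨h1, h2, h3⟩ := eq_zero_of_augLag_nonpos hρ hWy hWy0 hWd hWd0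
      (fun t ht => by simp [eY, show ¬ (1 ≤ t ∧ t ≤ (T : ℤ)) by omega])
      (fun t ht => by simp [eU, show ¬ (0 ≤ t ∧ t < (T : ℤ)) by omega]) hle
    refine Prod.ext (funext fun k => ?_) (Prod.ext (funext fun k => ?_) (funext fun k => ?_))
    · have h := h1 ((k : ℤ) + 1) (by omega)
      simpa [eY, sub_eq_zero, show (k : ℤ) + 1 ≤ T by omega] using h
    · have h := h2 k (by omega)
      simpa [eU, sub_eq_zero] using h
    · have h := h3 ((k : ℤ) + 1) (by rw [Finset.mem_Icc]; omega)
      simpa [eU, sub_eq_zero] using h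
  exact ⟨hL, fun S _ hS p hp q hq hpm hqm =>
    (hL.subset (Set.subset_univ S) hS).eq_of_isMinOn hpm hqm hp hq⟩
end

section
/- Fix t ∈ {1,…,T} and set j := min(na, T−t). Define H_t := (1/ρ) W^y + I_{ny} + Σ_{n=1}^{j} A(n)ᵀ A(n) and ê_t := −(1/ρ) W^y r_t − λ_t − Σ_{i=1}^{na} A(i) y_{t−i} − Σ_{i=1}^{nb} B(i) u_{t−i} + Σ_{n=1}^{j} A(n)ᵀ ( λ_{t+n} + Σ_{i=1, i≠n}^{na} A(i) y_{t+n−i} + Σ_{i=1}^{nb} B(i) u_{t+n−i} − y_{t+n} ). Then there exists a constant c ∈ ℝ such that for every v ∈ ℝ^{ny}, the value of ℓ obtained by replacing y_t with v while keeping all other decision variables fixed equals (1/2) vᵀ H_t v + vᵀ ê_t + c. (For t = T this reduces to H_T = (1/ρ)W^y + I and ê_T = −(1/ρ)W^y r_T − λ_T − Σ_{i=1}^{na} A(i) y_{T−i} − Σ_{i=1}^{nb} B(i) u_{T−i}, since j = 0.) -/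
open Matrix

/-- The residual at time `t` as a function of the output block `y_t`. -/
lemma arxRes_update_self (na nb ny nu : ℕ) (A : ℕ → Matrix (Fin ny) (Fin ny) ℝ)
    (B : ℕ → Matrix (Fin ny) (Fin nu) ℝ) (Y : ℤ → Fin ny → ℝ) (U : ℤ → Fin nu → ℝ)
    (t : ℤ) (v : Fin ny → ℝ) :
    arxRes na nb ny nu A B (Function.update Y t v) U t =
      (∑ i ∈ Finset.Icc 1 na, A i *ᵥ Y (t - i)) +
        (∑ i ∈ Finset.Icc 1 nb, B i *ᵥ U (t - i)) - v := by
  unfold arxRes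
  rw [Function.update_self]
  congr 2
  refine Finset.sum_congr rfl fun i hi => ?_
  rw [Finset.mem_Icc] at hi
  rw [Function.update_of_ne (by lia)]

/-- The residual at time `t + n`, `1 ≤ n ≤ na`, is affine in `y_t` with linear part `A n`. -/
lemma arxRes_update_add (na nb ny nu : ℕ) (A : ℕ → Matrix (Fin ny) (Fin ny) ℝ)
    (B : ℕ → Matrix (Fin ny) (Fin nu) ℝ) (Y : ℤ → Fin ny → ℝ) (U : ℤ → Fin nu → ℝ)
    (t : ℤ) (v : Fin ny → ℝ) {n : ℕ} (hn : n ∈ Finset.Icc 1 na) :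
    arxRes na nb ny nu A B (Function.update Y t v) U (t + n) =
      A n *ᵥ v + ((∑ i ∈ (Finset.Icc 1 na).erase n, A i *ᵥ Y (t + n - i)) +
        (∑ i ∈ Finset.Icc 1 nb, B i *ᵥ U (t + n - i)) - Y (t + n)) := by
  have hn1 := (Finset.mem_Icc.mp hn).1
  have h : ∑ i ∈ (Finset.Icc 1 na).erase n, A i *ᵥ Function.update Y t v (t + n - i) =
      ∑ i ∈ (Finset.Icc 1 na).erase n, A i *ᵥ Y (t + n - i) := by
    refine Finset.sum_congr rfl fun i hi => ?_
    have hne := Finset.ne_of_mem_erase hi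
    rw [Function.update_of_ne (by lia)]
  unfold arxRes
  rw [← Finset.add_sum_erase _ _ hn, h, add_sub_cancel_right, Function.update_self,
    Function.update_of_ne (by lia)]
  abel

/-- Residuals at times other than `t, …, t + na` do not depend on `y_t`. -/
lemma arxRes_update_of_ne (na nb ny nu : ℕ) (A : ℕ → Matrix (Fin ny) (Fin ny) ℝ)
    (B : ℕ → Matrix (Fin ny) (Fin nu) ℝ) (Y : ℤ → Fin ny → ℝ) (U : ℤ → Fin nu → ℝ)
    (t : ℤ) (v : Fin ny → ℝ) {s : ℤ} (hs : s ≠ t)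
    (hsn : ∀ n ∈ Finset.Icc 1 na, s ≠ t + n) :
    arxRes na nb ny nu A B (Function.update Y t v) U s = arxRes na nb ny nu A B Y U s := by
  unfold arxRes
  rw [Function.update_of_ne hs]
  congr 2
  refine Finset.sum_congr rfl fun i hi => ?_
  have := hsn i hi
  rw [Function.update_of_ne (by lia)]

/-- A sum over `1, …, T` of terms supported on `t, …, t + m` is a sum over
`t, …, t + min m (T - t)`. -/
lemma sum_Icc_eq_add_sum_shift {M : Type*} [AddCommMonoid M] (T m : ℕ) (t : ℤ)
    (ht1 : 1 ≤ t) (htT : t ≤ T) (g : ℤ → M)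
    (hg : ∀ s, s ≠ t → (∀ n ∈ Finset.Icc 1 m, s ≠ t + n) → g s = 0) :
    ∑ s ∈ Finset.Icc (1 : ℤ) T, g s =
      g t + ∑ n ∈ Finset.Icc 1 (min m ((T : ℤ) - t).toNat), g (t + n) := by
  rw [← Finset.add_sum_erase _ _ (Finset.mem_Icc.mpr ⟨ht1, htT⟩)]
  congr 1
  symm
  refine Finset.sum_of_injOn (fun n : ℕ => t + n) (fun a _ b _ h => by simpa using h)
    (fun n hn => ?_) (fun s hs hs' => ?_) (fun _ _ => rfl)
  · simp only [Finset.coe_Icc, Set.mem_Icc] at hn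
    simp only [Finset.coe_erase, Finset.coe_Icc, Set.mem_sdiff, Set.mem_Icc,
      Set.mem_singleton_iff]
    lia
  · simp only [Finset.mem_erase, Finset.mem_Icc] at hs
    refine hg s hs.1 fun n hn h => hs' ⟨n, ?_, h.symm⟩
    simp only [Finset.mem_Icc] at hn
    simp only [Finset.coe_Icc, Set.mem_Icc]
    lia

/-- Expansion of a quadratic form with symmetric matrix around a reference point. -/
lemma sub_dotProduct_mulVec_sub {n : Type*} [Fintype n] {W : Matrix n n ℝ} (hW : W.IsSymm)
    (v r : n → ℝ) :
    (v - r) ⬝ᵥ (W *ᵥ (v - r)) =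
      v ⬝ᵥ (W *ᵥ v) - 2 * (v ⬝ᵥ (W *ᵥ r)) + r ⬝ᵥ (W *ᵥ r) := by
  have h : r ⬝ᵥ (W *ᵥ v) = v ⬝ᵥ (W *ᵥ r) := by
    rw [dotProduct_mulVec, ← mulVec_transpose, hW.eq, dotProduct_comm]
  simp only [mulVec_sub, dotProduct_sub, sub_dotProduct, h]
  ring

/-- Expansion of the multiplier and penalty terms of an affine residual `M v + b`. -/
lemma dotProduct_add_half_sq_affine {m n : Type*} [Fintype m] [Fintype n]
    (M : Matrix m n ℝ) (l b : m → ℝ) (v : n → ℝ) :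
    l ⬝ᵥ (M *ᵥ v + b) + (1 / 2) * ((M *ᵥ v + b) ⬝ᵥ (M *ᵥ v + b)) =
      (1 / 2) * (v ⬝ᵥ ((Mᵀ * M) *ᵥ v)) + v ⬝ᵥ (Mᵀ *ᵥ (l + b)) +
        (l ⬝ᵥ b + (1 / 2) * (b ⬝ᵥ b)) := by
  have h (x : m → ℝ) : v ⬝ᵥ (Mᵀ *ᵥ x) = x ⬝ᵥ (M *ᵥ v) := by
    rw [dotProduct_mulVec, vecMul_transpose, dotProduct_comm]
  rw [← mulVec_mulVec, h, h]
  simp only [dotProduct_add, add_dotProduct, dotProduct_comm (M *ᵥ v) b]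
  ring

/-- The part of the stage-`s` term of the augmented Lagrangian that involves the outputs. -/
noncomputable def outputStage (na nb ny nu : ℕ)
    (A : ℕ → Matrix (Fin ny) (Fin ny) ℝ) (B : ℕ → Matrix (Fin ny) (Fin nu) ℝ)
    (ρ : ℝ) (Wy : Matrix (Fin ny) (Fin ny) ℝ) (r lam : ℤ → Fin ny → ℝ)
    (Y : ℤ → Fin ny → ℝ) (U : ℤ → Fin nu → ℝ) (s : ℤ) : ℝ :=
  (1 / (2 * ρ)) * ((Y s - r s) ⬝ᵥ (Wy *ᵥ (Y s - r s))) +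
    (lam s ⬝ᵥ arxRes na nb ny nu A B Y U s +
      (1 / 2) * (arxRes na nb ny nu A B Y U s ⬝ᵥ arxRes na nb ny nu A B Y U s))

/-- Changing only the outputs changes the augmented Lagrangian by the change of its output
stages. -/
lemma augLag_sub_augLag (T na nb ny nu : ℕ)
    (A : ℕ → Matrix (Fin ny) (Fin ny) ℝ) (B : ℕ → Matrix (Fin ny) (Fin nu) ℝ)
    (ρ : ℝ) (Wy : Matrix (Fin ny) (Fin ny) ℝ) (Wd : Matrix (Fin nu) (Fin nu) ℝ)
    (r lam : ℤ → Fin ny → ℝ) (gam : ℤ → Fin nu → ℝ)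
    (Y Y' : ℤ → Fin ny → ℝ) (U ΔU : ℤ → Fin nu → ℝ) :
    augLag T na nb ny nu A B ρ Wy Wd r lam gam Y U ΔU -
        augLag T na nb ny nu A B ρ Wy Wd r lam gam Y' U ΔU =
      ∑ s ∈ Finset.Icc (1 : ℤ) T,
        (outputStage na nb ny nu A B ρ Wy r lam Y U s -
          outputStage na nb ny nu A B ρ Wy r lam Y' U s) := by
  simp only [augLag, outputStage, Finset.sum_sub_distrib, Finset.sum_add_distrib,
    ← Finset.mul_sum]
  ring

/-- Change of the output stage at time `t` as `y_t` moves from `0` to `v`. -/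
lemma outputStage_update_self (na nb ny nu : ℕ)
    (A : ℕ → Matrix (Fin ny) (Fin ny) ℝ) (B : ℕ → Matrix (Fin ny) (Fin nu) ℝ)
    (ρ : ℝ) {Wy : Matrix (Fin ny) (Fin ny) ℝ} (hWy : Wy.IsSymm) (r lam : ℤ → Fin ny → ℝ)
    (Y : ℤ → Fin ny → ℝ) (U : ℤ → Fin nu → ℝ) (t : ℤ) (v : Fin ny → ℝ) :
    outputStage na nb ny nu A B ρ Wy r lam (Function.update Y t v) U t -
        outputStage na nb ny nu A B ρ Wy r lam (Function.update Y t 0) U t =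
      (1 / 2) * (v ⬝ᵥ ((ρ⁻¹ • Wy + 1) *ᵥ v)) +
        v ⬝ᵥ (-(ρ⁻¹ • (Wy *ᵥ r t)) - lam t
          - (∑ i ∈ Finset.Icc 1 na, A i *ᵥ Y (t - i))
          - (∑ i ∈ Finset.Icc 1 nb, B i *ᵥ U (t - i))) := by
  simp only [outputStage, arxRes_update_self, Function.update_self,
    sub_dotProduct_mulVec_sub hWy]
  generalize ∑ i ∈ Finset.Icc 1 na, A i *ᵥ Y (t - i) = a
  generalize ∑ i ∈ Finset.Icc 1 nb, B i *ᵥ U (t - i) = b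
  simp only [add_mulVec, smul_mulVec, one_mulVec, dotProduct_add, dotProduct_sub,
    add_dotProduct, sub_dotProduct, dotProduct_neg, dotProduct_smul, smul_eq_mul,
    zero_dotProduct, dotProduct_zero, dotProduct_comm _ v, dotProduct_comm b a]
  ring

/-- Change of the output stage at time `t + n`, `1 ≤ n ≤ na`, as `y_t` moves from `0` to `v`. -/
lemma outputStage_update_add (na nb ny nu : ℕ)
    (A : ℕ → Matrix (Fin ny) (Fin ny) ℝ) (B : ℕ → Matrix (Fin ny) (Fin nu) ℝ)
    (ρ : ℝ) (Wy : Matrix (Fin ny) (Fin ny) ℝ) (r lam : ℤ → Fin ny → ℝ)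
    (Y : ℤ → Fin ny → ℝ) (U : ℤ → Fin nu → ℝ) (t : ℤ) (v : Fin ny → ℝ)
    {n : ℕ} (hn : n ∈ Finset.Icc 1 na) :
    outputStage na nb ny nu A B ρ Wy r lam (Function.update Y t v) U (t + n) -
        outputStage na nb ny nu A B ρ Wy r lam (Function.update Y t 0) U (t + n) =
      (1 / 2) * (v ⬝ᵥ (((A n)ᵀ * A n) *ᵥ v)) +
        v ⬝ᵥ ((A n)ᵀ *ᵥ
          (lam (t + n) + (∑ i ∈ (Finset.Icc 1 na).erase n, A i *ᵥ Y (t + n - i))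
            + (∑ i ∈ Finset.Icc 1 nb, B i *ᵥ U (t + n - i)) - Y (t + n))) := by
  have hne : t + (n : ℤ) ≠ t := by
    have := (Finset.mem_Icc.mp hn).1
    lia
  simp only [outputStage, arxRes_update_add _ _ _ _ _ _ _ _ _ _ hn,
    Function.update_of_ne hne]
  generalize ∑ i ∈ (Finset.Icc 1 na).erase n, A i *ᵥ Y (t + n - i) = a
  generalize ∑ i ∈ Finset.Icc 1 nb, B i *ᵥ U (t + n - i) = b
  rw [dotProduct_add_half_sq_affine, dotProduct_add_half_sq_affine, zero_dotProduct,
    zero_dotProduct, ← add_sub_assoc (lam _), ← add_assoc (lam _)]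
  ring

/-- The value of the augmented Lagrangian as a function of the output block `y_t`
(all other decision variables fixed) is the quadratic `(1/2) vᵀ H_t v + vᵀ ê_t + c`
with `H_t = (1/ρ)W^y + I + Σ_{n=1}^{j} A(n)ᵀA(n)`, `j = min(na, T-t)`. -/
theorem augLag_output_block_quadratic (T na nb ny nu : ℕ)
    (hT : 1 ≤ T) (hna : 1 ≤ na) (hnb : 1 ≤ nb) (hny : 1 ≤ ny) (hnu : 1 ≤ nu)
    (A : ℕ → Matrix (Fin ny) (Fin ny) ℝ) (B : ℕ → Matrix (Fin ny) (Fin nu) ℝ)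
    (ρ : ℝ) (hρ : 0 < ρ)
    (Wy : Matrix (Fin ny) (Fin ny) ℝ) (Wd : Matrix (Fin nu) (Fin nu) ℝ)
    (hWy : Wy.IsDiag) (hWd : Wd.IsDiag)
    (r lam : ℤ → Fin ny → ℝ) (gam : ℤ → Fin nu → ℝ)
    (Y : ℤ → Fin ny → ℝ) (U ΔU : ℤ → Fin nu → ℝ)
    (t : ℤ) (ht1 : 1 ≤ t) (htT : t ≤ T) :
    let j : ℕ := min na ((T : ℤ) - t).toNat
    let H : Matrix (Fin ny) (Fin ny) ℝ :=
      ρ⁻¹ • Wy + 1 + ∑ n ∈ Finset.Icc 1 j, (A n)ᵀ * A n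
    let e : Fin ny → ℝ :=
      -(ρ⁻¹ • (Wy *ᵥ r t)) - lam t
        - (∑ i ∈ Finset.Icc 1 na, A i *ᵥ Y (t - i))
        - (∑ i ∈ Finset.Icc 1 nb, B i *ᵥ U (t - i))
        + ∑ n ∈ Finset.Icc 1 j, (A n)ᵀ *ᵥ
            (lam (t + n) + (∑ i ∈ (Finset.Icc 1 na).erase n, A i *ᵥ Y (t + n - i))
              + (∑ i ∈ Finset.Icc 1 nb, B i *ᵥ U (t + n - i)) - Y (t + n))
    ∃ c : ℝ, ∀ v : Fin ny → ℝ,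
      augLag T na nb ny nu A B ρ Wy Wd r lam gam (Function.update Y t v) U ΔU
        = (1 / 2) * (v ⬝ᵥ (H *ᵥ v)) + v ⬝ᵥ e + c := by
  intro j H e
  refine ⟨augLag T na nb ny nu A B ρ Wy Wd r lam gam (Function.update Y t 0) U ΔU, fun v => ?_⟩
  rw [← sub_eq_iff_eq_add, augLag_sub_augLag,
    sum_Icc_eq_add_sum_shift T na t ht1 htT _ fun s hs hsn => ?_,
    outputStage_update_self _ _ _ _ _ _ _ hWy.isSymm,
    Finset.sum_congr rfl fun n hn => outputStage_update_add na nb ny nu A B ρ Wy r lam Y U t v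
      (Finset.Icc_subset_Icc_right (min_le_left _ _) hn)]
  · simp only [H, e, j, add_mulVec, sum_mulVec, dotProduct_add, dotProduct_sum,
      Finset.sum_add_distrib, ← Finset.mul_sum]
    ring
  · simp only [outputStage, arxRes_update_of_ne _ _ _ _ _ _ _ _ _ _ hs hsn,
      Function.update_of_ne hs, sub_self]
end

section
/- Fix t ∈ {1,…,T} and set j := min(nb, T−t+1). Define H_t^u := κ_t I_{nu} + Σ_{n=1}^{j} B(n)ᵀ B(n), where κ_t = 2 if t ≤ T−1 and κ_T = 1, and define f̂_t := −(γ_t + u_{t−2} + Δu_{t−1}) + χ_t + Σ_{n=1}^{j} B(n)ᵀ ( λ_{t−1+n} + Σ_{i=1}^{na} A(i) y_{t−1+n−i} + Σ_{i=1, i≠n}^{nb} B(i) u_{t−1+n−i} − y_{t−1+n} ), where χ_t = γ_{t+1} + Δu_t − u_t if t ≤ T−1 and χ_T = 0. Then there exists a constant c ∈ ℝ such that for every v ∈ ℝ^{nu}, the value of ℓ obtained by replacing u_{t−1} with v while keeping all other decision variables fixed equals (1/2) vᵀ H_t^u v + vᵀ f̂_t + c. -/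
open Matrix

/-- `φ` is, up to an additive constant, the quadratic `v ↦ (1/2) vᵀ H v + vᵀ f`. -/
def IsQuadraticUpToConst {m : ℕ} (φ : (Fin m → ℝ) → ℝ) (H : Matrix (Fin m) (Fin m) ℝ)
    (f : Fin m → ℝ) : Prop :=
  ∃ c : ℝ, ∀ v, φ v = (1 / 2) * (v ⬝ᵥ (H *ᵥ v)) + v ⬝ᵥ f + c

namespace IsQuadraticUpToConst

variable {m : ℕ} {φ ψ : (Fin m → ℝ) → ℝ} {H K : Matrix (Fin m) (Fin m) ℝ} {f g : Fin m → ℝ}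

theorem const (c : ℝ) : IsQuadraticUpToConst (fun _ : Fin m → ℝ => c) 0 0 :=
  ⟨c, fun v => by simp⟩

theorem add (hφ : IsQuadraticUpToConst φ H f) (hψ : IsQuadraticUpToConst ψ K g) :
    IsQuadraticUpToConst (fun v => φ v + ψ v) (H + K) (f + g) := by
  obtain ⟨c, hc⟩ := hφ
  obtain ⟨d, hd⟩ := hψ
  refine ⟨c + d, fun v => ?_⟩
  simp only [hc, hd, add_mulVec, dotProduct_add]
  ring

theorem sum {ι : Type*} (s : Finset ι) {φ : ι → (Fin m → ℝ) → ℝ}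
    {H : ι → Matrix (Fin m) (Fin m) ℝ} {f : ι → Fin m → ℝ}
    (h : ∀ i ∈ s, IsQuadraticUpToConst (φ i) (H i) (f i)) :
    IsQuadraticUpToConst (fun v => ∑ i ∈ s, φ i v) (∑ i ∈ s, H i) (∑ i ∈ s, f i) := by
  classical
  induction s using Finset.induction_on with
  | empty => simpa using const (m := m) 0
  | insert a s ha ih =>
    simp only [Finset.sum_insert ha]
    exact (h a (Finset.mem_insert_self a s)).add
      (ih fun i hi => h i (Finset.mem_insert_of_mem hi))

/-- Summands that do not depend on the variable may be dropped. -/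
theorem sum_of_subset {ι : Type*} [DecidableEq ι] {s t : Finset ι} (hst : s ⊆ t)
    {φ : ι → (Fin m → ℝ) → ℝ}
    (hs : IsQuadraticUpToConst (fun v => ∑ i ∈ s, φ i v) H f)
    (hconst : ∀ i ∈ t, i ∉ s → ∀ v, φ i v = φ i 0) :
    IsQuadraticUpToConst (fun v => ∑ i ∈ t, φ i v) H f := by
  have key := hs.add (const (∑ i ∈ t \ s, φ i 0))
  rw [add_zero, add_zero] at key
  convert key using 2 with v
  rw [← Finset.sum_sdiff hst, add_comm]
  congr 1
  refine Finset.sum_congr rfl fun i hi => ?_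
  rw [Finset.mem_sdiff] at hi
  exact hconst i hi.1 hi.2 v

/-- The augmented Lagrangian term of an affine residual `e + M v` with multiplier `a`. -/
theorem of_affine {k : ℕ} (a e : Fin k → ℝ) (M : Matrix (Fin k) (Fin m) ℝ) :
    IsQuadraticUpToConst
      (fun v => a ⬝ᵥ (e + M *ᵥ v) + (1 / 2) * ((e + M *ᵥ v) ⬝ᵥ (e + M *ᵥ v)))
      (Mᵀ * M) (Mᵀ *ᵥ (a + e)) := by
  refine ⟨a ⬝ᵥ e + (1 / 2) * (e ⬝ᵥ e), fun v => ?_⟩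
  have h (w : Fin k → ℝ) : v ⬝ᵥ (Mᵀ *ᵥ w) = w ⬝ᵥ (M *ᵥ v) := by
    rw [dotProduct_mulVec, vecMul_transpose, dotProduct_comm]
  rw [← mulVec_mulVec, h, h]
  simp only [dotProduct_add, add_dotProduct]
  rw [dotProduct_comm (M *ᵥ v) e]
  ring

end IsQuadraticUpToConst

theorem arxRes_update_of_mem {na nb ny nu : ℕ} (A : ℕ → Matrix (Fin ny) (Fin ny) ℝ)
    (B : ℕ → Matrix (Fin ny) (Fin nu) ℝ) (Y : ℤ → Fin ny → ℝ) (U : ℤ → Fin nu → ℝ) (p : ℤ)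
    {n : ℕ} (hn : n ∈ Finset.Icc 1 nb) (v : Fin nu → ℝ) :
    arxRes na nb ny nu A B Y (Function.update U p v) (p + n)
      = (∑ i ∈ Finset.Icc 1 na, A i *ᵥ Y (p + n - i))
          + (∑ i ∈ (Finset.Icc 1 nb).erase n, B i *ᵥ U (p + n - i)) - Y (p + n)
          + B n *ᵥ v := by
  have h : ∑ i ∈ (Finset.Icc 1 nb).erase n, B i *ᵥ Function.update U p v (p + n - i)
      = ∑ i ∈ (Finset.Icc 1 nb).erase n, B i *ᵥ U (p + n - i) := by
    refine Finset.sum_congr rfl fun i hi => ?_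
    have hi' := Finset.ne_of_mem_erase hi
    rw [Function.update_of_ne (by omega)]
  rw [arxRes, ← Finset.sum_erase_add _ _ hn, h, add_sub_cancel_right, Function.update_self]
  abel

theorem arxRes_update_of_forall_ne {na nb ny nu : ℕ} (A : ℕ → Matrix (Fin ny) (Fin ny) ℝ)
    (B : ℕ → Matrix (Fin ny) (Fin nu) ℝ) (Y : ℤ → Fin ny → ℝ) (U : ℤ → Fin nu → ℝ) {p s : ℤ}
    (hs : ∀ i ∈ Finset.Icc 1 nb, s - (i : ℤ) ≠ p) (v : Fin nu → ℝ) :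
    arxRes na nb ny nu A B Y (Function.update U p v) s = arxRes na nb ny nu A B Y U s := by
  have h : ∑ i ∈ Finset.Icc 1 nb, B i *ᵥ Function.update U p v (s - i)
      = ∑ i ∈ Finset.Icc 1 nb, B i *ᵥ U (s - i) :=
    Finset.sum_congr rfl fun i hi => by rw [Function.update_of_ne (hs i hi)]
  rw [arxRes, arxRes, h]

/-- The input block `u_{t-1}` enters the ARX terms through `res_t, …, res_{t-1+j}`. -/
theorem isQuadraticUpToConst_arxRes_sum {na nb ny nu : ℕ} (T : ℕ)
    (A : ℕ → Matrix (Fin ny) (Fin ny) ℝ) (B : ℕ → Matrix (Fin ny) (Fin nu) ℝ)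
    (lam Y : ℤ → Fin ny → ℝ) (U : ℤ → Fin nu → ℝ) {t : ℤ} (ht : 1 ≤ t) :
    IsQuadraticUpToConst
      (fun v => ∑ s ∈ Finset.Icc (1 : ℤ) T,
        (lam s ⬝ᵥ arxRes na nb ny nu A B Y (Function.update U (t - 1) v) s
          + (1 / 2) * (arxRes na nb ny nu A B Y (Function.update U (t - 1) v) s
            ⬝ᵥ arxRes na nb ny nu A B Y (Function.update U (t - 1) v) s)))
      (∑ n ∈ Finset.Icc 1 (min nb ((T : ℤ) - t + 1).toNat), (B n)ᵀ * B n)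
      (∑ n ∈ Finset.Icc 1 (min nb ((T : ℤ) - t + 1).toNat), (B n)ᵀ *ᵥ
        (lam (t - 1 + n) + (∑ i ∈ Finset.Icc 1 na, A i *ᵥ Y (t - 1 + n - i))
          + (∑ i ∈ (Finset.Icc 1 nb).erase n, B i *ᵥ U (t - 1 + n - i))
          - Y (t - 1 + n))) := by
  have hinj : Function.Injective fun n : ℕ => t - 1 + (n : ℤ) := fun a b h => by
    simpa using h
  refine IsQuadraticUpToConst.sum_of_subset
    (s := (Finset.Icc 1 (min nb ((T : ℤ) - t + 1).toNat)).image fun n : ℕ => t - 1 + (n : ℤ))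
    ?_ ?_ ?_
  · intro s hs
    simp only [Finset.mem_image, Finset.mem_Icc] at hs ⊢
    omega
  · simp only [Finset.sum_image hinj.injOn]
    refine IsQuadraticUpToConst.sum _ fun n hn => ?_
    have hn' : n ∈ Finset.Icc 1 nb := by
      simp only [Finset.mem_Icc] at hn ⊢
      omega
    simp only [arxRes_update_of_mem A B Y U (t - 1) hn']
    convert IsQuadraticUpToConst.of_affine (lam (t - 1 + n)) _ (B n) using 2
    abel
  · intro s hs hs' v
    have h : ∀ i ∈ Finset.Icc 1 nb, s - (i : ℤ) ≠ t - 1 := fun i hi hsi => hs' <| by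
      simp only [Finset.mem_Icc] at hs hi
      exact Finset.mem_image.2 ⟨i, by simp only [Finset.mem_Icc]; omega, by omega⟩
    simp only [arxRes_update_of_forall_ne A B Y U h]

/-- The input block `u_{t-1}` enters the increment terms through `d_t` and, if `t < T`,
through `d_{t+1}`. -/
theorem isQuadraticUpToConst_incRes_sum {nu : ℕ} (T : ℕ) (gam U ΔU : ℤ → Fin nu → ℝ) {t : ℤ}
    (ht : 1 ≤ t) (htT : t ≤ T) :
    IsQuadraticUpToConst
      (fun v => ∑ s ∈ Finset.Icc (1 : ℤ) T,
        (gam s ⬝ᵥ incRes nu (Function.update U (t - 1) v) ΔU s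
          + (1 / 2) * (incRes nu (Function.update U (t - 1) v) ΔU s
            ⬝ᵥ incRes nu (Function.update U (t - 1) v) ΔU s)))
      ((if t ≤ (T : ℤ) - 1 then (2 : ℝ) else 1) • (1 : Matrix (Fin nu) (Fin nu) ℝ))
      (-(gam t + U (t - 2) + ΔU (t - 1))
        + if t ≤ (T : ℤ) - 1 then gam (t + 1) + ΔU t - U t else 0) := by
  have hcur (v : Fin nu → ℝ) : incRes nu (Function.update U (t - 1) v) ΔU t
      = U (t - 2) + ΔU (t - 1) + (-1 : Matrix (Fin nu) (Fin nu) ℝ) *ᵥ v := by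
    rw [incRes, Function.update_self, Function.update_of_ne (by omega), neg_mulVec, one_mulVec,
      sub_eq_add_neg]
  have hnext (v : Fin nu → ℝ) : incRes nu (Function.update U (t - 1) v) ΔU (t + 1)
      = ΔU t - U t + (1 : Matrix (Fin nu) (Fin nu) ℝ) *ᵥ v := by
    rw [incRes, show t + 1 - 2 = t - 1 by ring, Function.update_self, add_sub_cancel_right,
      Function.update_of_ne (by omega), one_mulVec]
    abel
  have hother {s : ℤ} (h₁ : s ≠ t) (h₂ : s ≠ t + 1) (v : Fin nu → ℝ) :
      incRes nu (Function.update U (t - 1) v) ΔU s = incRes nu U ΔU s := by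
    rw [incRes, incRes, Function.update_of_ne (by omega), Function.update_of_ne (by omega)]
  have quad_cur := IsQuadraticUpToConst.of_affine (gam t) (U (t - 2) + ΔU (t - 1))
    (-1 : Matrix (Fin nu) (Fin nu) ℝ)
  simp only [← hcur] at quad_cur
  split_ifs with hlt
  · have quad_next := IsQuadraticUpToConst.of_affine (gam (t + 1)) (ΔU t - U t)
      (1 : Matrix (Fin nu) (Fin nu) ℝ)
    simp only [← hnext] at quad_next
    refine IsQuadraticUpToConst.sum_of_subset (s := {t, t + 1}) ?_ ?_ ?_
    · intro s hs
      simp only [Finset.mem_insert, Finset.mem_singleton, Finset.mem_Icc] at hs ⊢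
      omega
    · simp only [Finset.sum_pair (show t ≠ t + 1 by omega)]
      convert quad_cur.add quad_next using 1
      · simp [two_smul]
      · simp only [transpose_neg, transpose_one, neg_mulVec, one_mulVec]
        abel
    · intro s _ hs v
      simp only [Finset.mem_insert, Finset.mem_singleton, not_or] at hs
      simp only [hother hs.1 hs.2]
  · refine IsQuadraticUpToConst.sum_of_subset (s := {t}) ?_ ?_ ?_
    · intro s hs
      simp only [Finset.mem_singleton, Finset.mem_Icc] at hs ⊢
      omega
    · simp only [Finset.sum_singleton]
      convert quad_cur using 1
      · simp
      · simp only [transpose_neg, transpose_one, neg_mulVec, one_mulVec]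
        abel
    · intro s hs hs' v
      simp only [Finset.mem_singleton, Finset.mem_Icc] at hs hs'
      simp only [hother hs' (by omega)]

/-- The value of the augmented Lagrangian as a function of the input block `u_{t-1}`
(all other decision variables fixed) is the quadratic `(1/2) vᵀ H_t^u v + vᵀ f̂_t + c`
with `H_t^u = κ_t I + Σ_{n=1}^{j} B(n)ᵀB(n)`, `j = min(nb, T-t+1)`,
`κ_t = 2` for `t ≤ T-1` and `κ_T = 1`. -/
theorem augLag_input_block_quadratic (T na nb ny nu : ℕ)
    (hT : 1 ≤ T) (hna : 1 ≤ na) (hnb : 1 ≤ nb) (hny : 1 ≤ ny) (hnu : 1 ≤ nu)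
    (A : ℕ → Matrix (Fin ny) (Fin ny) ℝ) (B : ℕ → Matrix (Fin ny) (Fin nu) ℝ)
    (ρ : ℝ) (hρ : 0 < ρ)
    (Wy : Matrix (Fin ny) (Fin ny) ℝ) (Wd : Matrix (Fin nu) (Fin nu) ℝ)
    (hWy : Wy.IsDiag) (hWd : Wd.IsDiag)
    (r lam : ℤ → Fin ny → ℝ) (gam : ℤ → Fin nu → ℝ)
    (Y : ℤ → Fin ny → ℝ) (U ΔU : ℤ → Fin nu → ℝ)
    (t : ℤ) (ht1 : 1 ≤ t) (htT : t ≤ T) :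
    let j : ℕ := min nb ((T : ℤ) - t + 1).toNat
    let κ : ℝ := if t ≤ (T : ℤ) - 1 then 2 else 1
    let H : Matrix (Fin nu) (Fin nu) ℝ :=
      κ • (1 : Matrix (Fin nu) (Fin nu) ℝ) + ∑ n ∈ Finset.Icc 1 j, (B n)ᵀ * B n
    let χ : Fin nu → ℝ := if t ≤ (T : ℤ) - 1 then gam (t + 1) + ΔU t - U t else 0
    let f : Fin nu → ℝ :=
      -(gam t + U (t - 2) + ΔU (t - 1)) + χ
        + ∑ n ∈ Finset.Icc 1 j, (B n)ᵀ *ᵥ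
            (lam (t - 1 + n) + (∑ i ∈ Finset.Icc 1 na, A i *ᵥ Y (t - 1 + n - i))
              + (∑ i ∈ (Finset.Icc 1 nb).erase n, B i *ᵥ U (t - 1 + n - i))
              - Y (t - 1 + n))
    ∃ c : ℝ, ∀ v : Fin nu → ℝ,
      augLag T na nb ny nu A B ρ Wy Wd r lam gam Y (Function.update U (t - 1) v) ΔU
        = (1 / 2) * (v ⬝ᵥ (H *ᵥ v)) + v ⬝ᵥ f + c := by
  intro j κ H χ f
  have key := ((isQuadraticUpToConst_incRes_sum T gam U ΔU ht1 htT).add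
    (isQuadraticUpToConst_arxRes_sum (na := na) (nb := nb) T A B lam Y U ht1)).add
    (IsQuadraticUpToConst.const ((1 / (2 * ρ)) * ∑ t ∈ Finset.Icc (1 : ℤ) T,
      ((Y t - r t) ⬝ᵥ (Wy *ᵥ (Y t - r t)) + ΔU (t - 1) ⬝ᵥ (Wd *ᵥ ΔU (t - 1)))))
  rw [add_zero, add_zero] at key
  obtain ⟨c, hc⟩ := key
  refine ⟨c, fun v => Eq.trans ?_ (hc v)⟩
  simp only [augLag, Finset.sum_add_distrib, Finset.mul_sum]
  ring
end

section
/- Fix t ∈ {1,…,T} and set j := min(na, T−t). Define H_t := (1/ρ) W^y + I_{ny} + Σ_{n=1}^{j} A(n)ᵀ A(n) and ê_t := −(1/ρ) W^y r_t − λ_t − Σ_{i=1}^{na} A(i) y_{t−i} − Σ_{i=1}^{nb} B(i) u_{t−i} + Σ_{n=1}^{j} A(n)ᵀ ( λ_{t+n} + Σ_{i=1, i≠n}^{na} A(i) y_{t+n−i} + Σ_{i=1}^{nb} B(i) u_{t+n−i} − y_{t+n} ). Define the residual-augmented multipliers λ̃_s := λ_s + res_s(Y,U) for s = 1,…,T.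 Then H_t y_t + ê_t = (1/ρ) W^y (y_t − r_t) − λ̃_t + Σ_{n=1}^{j} A(n)ᵀ λ̃_{t+n}. In other words, the gradient of the y_t-restricted quadratic can be evaluated using only the residual-augmented multipliers, without forming ê_t explicitly. -/
open Matrix

/-- The gradient `H_t y_t + ê_t` of the `y_t`-restricted quadratic of the augmented
Lagrangian can be evaluated from the residual-augmented multipliers
`λ̃_s = λ_s + res_s(Y,U)` alone:
`H_t y_t + ê_t = (1/ρ) W^y (y_t - r_t) - λ̃_t + Σ_{n=1}^{j} A(n)ᵀ λ̃_{t+n}`. -/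
theorem augLag_output_gradient_via_residual_multipliers (T na nb ny nu : ℕ)
    (hT : 1 ≤ T) (hna : 1 ≤ na) (hnb : 1 ≤ nb) (hny : 1 ≤ ny) (hnu : 1 ≤ nu)
    (A : ℕ → Matrix (Fin ny) (Fin ny) ℝ) (B : ℕ → Matrix (Fin ny) (Fin nu) ℝ)
    (ρ : ℝ) (hρ : 0 < ρ)
    (Wy : Matrix (Fin ny) (Fin ny) ℝ)
    (r lam : ℤ → Fin ny → ℝ)
    (Y : ℤ → Fin ny → ℝ) (U : ℤ → Fin nu → ℝ)
    (t : ℤ) (ht1 : 1 ≤ t) (htT : t ≤ T) :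
    let j : ℕ := min na ((T : ℤ) - t).toNat
    let H : Matrix (Fin ny) (Fin ny) ℝ :=
      ρ⁻¹ • Wy + 1 + ∑ n ∈ Finset.Icc 1 j, (A n)ᵀ * A n
    let e : Fin ny → ℝ :=
      -(ρ⁻¹ • (Wy *ᵥ r t)) - lam t
        - (∑ i ∈ Finset.Icc 1 na, A i *ᵥ Y (t - i))
        - (∑ i ∈ Finset.Icc 1 nb, B i *ᵥ U (t - i))
        + ∑ n ∈ Finset.Icc 1 j, (A n)ᵀ *ᵥ
            (lam (t + n) + (∑ i ∈ (Finset.Icc 1 na).erase n, A i *ᵥ Y (t + n - i))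
              + (∑ i ∈ Finset.Icc 1 nb, B i *ᵥ U (t + n - i)) - Y (t + n))
    let lamTilde : ℤ → Fin ny → ℝ := fun s => lam s + arxRes na nb ny nu A B Y U s
    H *ᵥ Y t + e
      = ρ⁻¹ • (Wy *ᵥ (Y t - r t)) - lamTilde t
          + ∑ n ∈ Finset.Icc 1 j, (A n)ᵀ *ᵥ lamTilde (t + n) := by
  intro j H e lamTilde
  have hsum : (∑ n ∈ Finset.Icc 1 j, (A n)ᵀ * A n) *ᵥ Y t
      + ∑ n ∈ Finset.Icc 1 j, (A n)ᵀ *ᵥ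
          (lam (t + n) + (∑ i ∈ (Finset.Icc 1 na).erase n, A i *ᵥ Y (t + n - i))
            + (∑ i ∈ Finset.Icc 1 nb, B i *ᵥ U (t + n - i)) - Y (t + n))
      = ∑ n ∈ Finset.Icc 1 j, (A n)ᵀ *ᵥ lamTilde (t + n) := by
    rw [Matrix.sum_mulVec, ← Finset.sum_add_distrib]
    refine Finset.sum_congr rfl fun n hn => ?_
    have hmem : n ∈ Finset.Icc 1 na :=
      Finset.Icc_subset_Icc_right (min_le_left _ _) hn
    have hsplit := Finset.add_sum_erase _ (fun i : ℕ => A i *ᵥ Y (t + n - i)) hmem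
    simp only [add_sub_cancel_right] at hsplit
    rw [← Matrix.mulVec_mulVec, ← Matrix.mulVec_add]
    simp only [lamTilde, arxRes, ← hsplit]
    congr 1
    abel
  rw [← hsum]
  simp only [H, e, lamTilde, arxRes, Matrix.add_mulVec, Matrix.one_mulVec, Matrix.smul_mulVec,
    Matrix.mulVec_sub, smul_sub]
  abel
end

section
/- Fix t ∈ {1,…,T} and set j := min(nb, T−t+1). Define H_t^u := κ_t I_{nu} + Σ_{n=1}^{j} B(n)ᵀ B(n), where κ_t = 2 if t ≤ T−1 and κ_T = 1, and f̂_t := −(γ_t + u_{t−2} + Δu_{t−1}) + χ_t + Σ_{n=1}^{j} B(n)ᵀ ( λ_{t−1+n} + Σ_{i=1}^{na} A(i) y_{t−1+n−i} + Σ_{i=1, i≠n}^{nb} B(i) u_{t−1+n−i} − y_{t−1+n} ), where χ_t = γ_{t+1} + Δu_t − u_t if t ≤ T−1 and χ_T = 0. Define the residual-augmented multipliers λ̃_s := λ_s + res_s(Y,U) and γ̃_s := γ_s + d_s(U,ΔU) for s = 1,…,T. Then H_t^u u_{t−1} + f̂_t = −γ̃_t + χ̃_t + Σ_{n=1}^{j}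 B(n)ᵀ λ̃_{t−1+n}, where χ̃_t = γ̃_{t+1} if t ≤ T−1 and χ̃_T = 0. -/
open Matrix

/-- Splitting the `n`-th input term off the ARX residual at time `s + n`. -/
theorem mulVec_add_erase_eq_arxRes {na nb ny nu : ℕ}
    (A : ℕ → Matrix (Fin ny) (Fin ny) ℝ) (B : ℕ → Matrix (Fin ny) (Fin nu) ℝ)
    (Y : ℤ → Fin ny → ℝ) (U : ℤ → Fin nu → ℝ) (s : ℤ) {n : ℕ}
    (hn : n ∈ Finset.Icc 1 nb) :
    B n *ᵥ U s + ((∑ i ∈ Finset.Icc 1 na, A i *ᵥ Y (s + n - i))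
        + (∑ i ∈ (Finset.Icc 1 nb).erase n, B i *ᵥ U (s + n - i)) - Y (s + n))
      = arxRes na nb ny nu A B Y U (s + n) := by
  rw [arxRes, ← Finset.add_sum_erase _ _ hn, add_sub_cancel_right]
  abel

/-- The gradient `H_t^u u_{t-1} + f̂_t` of the `u_{t-1}`-restricted quadratic of the
augmented Lagrangian can be evaluated from the residual-augmented multipliers
`λ̃_s = λ_s + res_s(Y,U)` and `γ̃_s = γ_s + d_s(U,ΔU)` alone:
`H_t^u u_{t-1} + f̂_t = -γ̃_t + χ̃_t + Σ_{n=1}^{j} B(n)ᵀ λ̃_{t-1+n}`, where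
`χ̃_t = γ̃_{t+1}` if `t ≤ T-1` and `χ̃_T = 0`. -/
theorem augLag_input_gradient_via_residual_multipliers (T na nb ny nu : ℕ)
    (hT : 1 ≤ T) (hna : 1 ≤ na) (hnb : 1 ≤ nb) (hny : 1 ≤ ny) (hnu : 1 ≤ nu)
    (A : ℕ → Matrix (Fin ny) (Fin ny) ℝ) (B : ℕ → Matrix (Fin ny) (Fin nu) ℝ)
    (ρ : ℝ) (hρ : 0 < ρ)
    (lam : ℤ → Fin ny → ℝ) (gam : ℤ → Fin nu → ℝ)
    (Y : ℤ → Fin ny → ℝ) (U ΔU : ℤ → Fin nu → ℝ)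
    (t : ℤ) (ht1 : 1 ≤ t) (htT : t ≤ T) :
    let j : ℕ := min nb ((T : ℤ) - t + 1).toNat
    let κ : ℝ := if t ≤ (T : ℤ) - 1 then 2 else 1
    let H : Matrix (Fin nu) (Fin nu) ℝ :=
      κ • (1 : Matrix (Fin nu) (Fin nu) ℝ) + ∑ n ∈ Finset.Icc 1 j, (B n)ᵀ * B n
    let χ : Fin nu → ℝ := if t ≤ (T : ℤ) - 1 then gam (t + 1) + ΔU t - U t else 0
    let f : Fin nu → ℝ :=
      -(gam t + U (t - 2) + ΔU (t - 1)) + χ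
        + ∑ n ∈ Finset.Icc 1 j, (B n)ᵀ *ᵥ
            (lam (t - 1 + n) + (∑ i ∈ Finset.Icc 1 na, A i *ᵥ Y (t - 1 + n - i))
              + (∑ i ∈ (Finset.Icc 1 nb).erase n, B i *ᵥ U (t - 1 + n - i))
              - Y (t - 1 + n))
    let lamTilde : ℤ → Fin ny → ℝ := fun s => lam s + arxRes na nb ny nu A B Y U s
    let gamTilde : ℤ → Fin nu → ℝ := fun s => gam s + incRes nu U ΔU s
    let χTilde : Fin nu → ℝ := if t ≤ (T : ℤ) - 1 then gamTilde (t + 1) else 0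
    H *ᵥ U (t - 1) + f
      = -gamTilde t + χTilde
          + ∑ n ∈ Finset.Icc 1 j, (B n)ᵀ *ᵥ lamTilde (t - 1 + n) := by
  intro j κ H χ f lamTilde gamTilde χTilde
  have hsum : (∑ n ∈ Finset.Icc 1 j, (B n)ᵀ * B n) *ᵥ U (t - 1)
      + ∑ n ∈ Finset.Icc 1 j, (B n)ᵀ *ᵥ
            (lam (t - 1 + n) + (∑ i ∈ Finset.Icc 1 na, A i *ᵥ Y (t - 1 + n - i))
              + (∑ i ∈ (Finset.Icc 1 nb).erase n, B i *ᵥ U (t - 1 + n - i))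
              - Y (t - 1 + n))
      = ∑ n ∈ Finset.Icc 1 j, (B n)ᵀ *ᵥ lamTilde (t - 1 + n) := by
    rw [Matrix.sum_mulVec, ← Finset.sum_add_distrib]
    refine Finset.sum_congr rfl fun n hn => ?_
    have hn' : n ∈ Finset.Icc 1 nb :=
      Finset.Icc_subset_Icc_right (min_le_left _ _) hn
    rw [← Matrix.mulVec_mulVec, ← Matrix.mulVec_add]
    simp only [lamTilde, ← mulVec_add_erase_eq_arxRes A B Y U (t - 1) hn']
    congr 1
    abel
  have hinc : κ • U (t - 1) + (-(gam t + U (t - 2) + ΔU (t - 1)) + χ)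
      = -gamTilde t + χTilde := by
    have h1 : t + 1 - 2 = t - 1 := by ring
    by_cases h : t ≤ (T : ℤ) - 1
    · simp only [κ, χ, χTilde, gamTilde, incRes, if_pos h, h1, add_sub_cancel_right, two_smul]
      abel
    · simp only [κ, χ, χTilde, gamTilde, incRes, if_neg h, one_smul]
      abel
  rw [← hsum, ← hinc]
  simp only [H, f, Matrix.add_mulVec, Matrix.smul_mulVec, Matrix.one_mulVec]
  abel
end

section
/- Assume W^y is diagonal with nonnegative diagonal entries, and let y_min, y_max ∈ ℝ^{ny} with y_min ≤ y_max componentwise. Fix t ∈ {1,…,T}, a coordinate i ∈ {1,…,ny}, and set j := min(na, T−t), H_t := (1/ρ) W^y + I_{ny} + Σ_{n=1}^{j} A(n)ᵀ A(n), and λ̃_s := λ_s + res_s(Y,U) for s = 1,…,T. Then the function θ ↦ ℓ(Y', U, ΔU), where Y' is obtained from Y by replacing the i-th entry of y_t with θ, has a unique minimizer over the interval [y_{min,i}, y_{max,i}], and this minimizer equals max( y_{min,i}, min( y_{max,i}, y_{t,i} − ( (1/ρ) W^y_{ii} (y_{t,i} − r_{t,i}) − λ̃_{t,i} + Σ_{n=1}^{j}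 (A(n)ᵀ λ̃_{t+n})_i ) / (H_t)_{ii} ) ). (Note that (H_t)_{ii} ≥ 1 > 0 automatically.) -/
open Matrix

/-- Clipping the vertex of a strictly convex quadratic gives its unique minimizer on an interval. -/
theorem clip_isUniqueMin_quadratic {g : ℝ → ℝ} {a b y c h c₀ : ℝ} (hab : a ≤ b) (hh : 0 < h)
    (hg : ∀ θ, g θ = c₀ + c * (θ - y) + h / 2 * (θ - y) ^ 2) :
    max a (min b (y - c / h)) ∈ Set.Icc a b ∧
      (∀ θ ∈ Set.Icc a b, g (max a (min b (y - c / h))) ≤ g θ) ∧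
      (∀ θ ∈ Set.Icc a b, (∀ η ∈ Set.Icc a b, g θ ≤ g η) →
        θ = max a (min b (y - c / h))) := by
  obtain ⟨p, hp⟩ : ∃ p, p = y - c / h := ⟨_, rfl⟩
  rw [← hp]
  set m := max a (min b p) with hm
  have hmem : m ∈ Set.Icc a b := ⟨le_max_left _ _, max_le hab (min_le_left _ _)⟩
  have hc : c = h * (y - p) := by rw [hp]; field_simp; ring
  have hvar : ∀ θ ∈ Set.Icc a b, 0 ≤ (θ - m) * (m - p) := by
    rintro θ ⟨h1, h2⟩
    rcases le_total p a with hpa | hpa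
    · have : m = a := by rw [hm, min_eq_right (hpa.trans hab), max_eq_left hpa]
      rw [this]
      exact mul_nonneg (by linarith) (by linarith)
    · rcases le_total p b with hpb | hpb
      · have : m = p := by rw [hm, min_eq_right hpb, max_eq_right hpa]
        simp [this]
      · have : m = b := by rw [hm, min_eq_left hpb, max_eq_right hab]
        rw [this]
        exact mul_nonneg_of_nonpos_of_nonpos (by linarith) (by linarith)
  have hgap : ∀ θ ∈ Set.Icc a b, h / 2 * (θ - m) ^ 2 ≤ g θ - g m := by
    intro θ hθ
    have : g θ - g m = h / 2 * (θ - m) ^ 2 + h * ((θ - m) * (m - p)) := by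
      rw [hg, hg, hc]; ring
    have := mul_nonneg hh.le (hvar θ hθ)
    linarith
  refine ⟨hmem, fun θ hθ => ?_, fun θ hθ hmin => ?_⟩
  · have := hgap θ hθ
    have : 0 ≤ h / 2 * (θ - m) ^ 2 := by positivity
    linarith
  · have h1 := hgap θ hθ
    have h2 := hmin m hmem
    have h3 : (θ - m) ^ 2 = 0 := by
      by_contra hne
      have : 0 < h / 2 * (θ - m) ^ 2 := by positivity
      linarith
    exact sub_eq_zero.mp (pow_eq_zero_iff two_ne_zero |>.mp h3)

/-- A sum over the horizon of a function supported on `{t, …, t + na}`. -/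
theorem sum_horizon_eq (T na : ℕ) {t : ℤ} (ht1 : 1 ≤ t) (htT : t ≤ T) (f : ℤ → ℝ)
    (hf : ∀ s, s ≠ t → (∀ n ∈ Finset.Icc 1 na, s ≠ t + (n : ℕ)) → f s = 0) :
    ∑ s ∈ Finset.Icc (1 : ℤ) T, f s =
      f t + ∑ n ∈ Finset.Icc 1 (min na ((T : ℤ) - t).toNat), f (t + n) := by
  have hinj : Set.InjOn (fun n : ℕ => t + (n : ℤ))
      (Finset.Icc 1 (min na ((T : ℤ) - t).toNat)) := by
    intro a _ b _ hab
    simpa using hab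
  rw [← Finset.sum_image hinj, ← Finset.sum_insert]
  · symm
    apply Finset.sum_subset
    · intro s hs
      simp only [Finset.mem_insert, Finset.mem_image, Finset.mem_Icc] at hs ⊢
      rcases hs with rfl | ⟨n, hn, rfl⟩ <;> omega
    · intro s hs hs'
      simp only [Finset.mem_insert, Finset.mem_image, Finset.mem_Icc, not_or, not_exists,
        not_and] at hs hs'
      refine hf s hs'.1 fun n hn hsn => hs'.2 n ?_ hsn.symm
      simp only [Finset.mem_Icc] at hn
      omega
  · simp only [Finset.mem_image, Finset.mem_Icc, not_exists, not_and]
    intro n hn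
    omega

/-- The derivative of `arxRes` at time `s` along the `i`-th output coordinate at time `t`. -/
noncomputable def arxResDir (na ny : ℕ) (A : ℕ → Matrix (Fin ny) (Fin ny) ℝ) (t : ℤ) (i : Fin ny)
    (s : ℤ) : Fin ny → ℝ :=
  (∑ k ∈ Finset.Icc 1 na, if s - k = t then (A k).col i else 0) -
    if s = t then Pi.single i 1 else 0

theorem update_update_apply_eq_add {ny : ℕ} (Y : ℤ → Fin ny → ℝ) (t : ℤ) (i : Fin ny) (θ : ℝ)
    (s : ℤ) :
    Function.update Y t (Function.update (Y t) i θ) s =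
      Y s + (θ - Y t i) • if s = t then Pi.single i 1 else 0 := by
  by_cases hs : s = t
  · subst hs
    ext k
    by_cases hk : k = i
    · subst hk; simp
    · simp [hk]
  · simp [hs]

theorem arxRes_update (na nb ny nu : ℕ) (A : ℕ → Matrix (Fin ny) (Fin ny) ℝ)
    (B : ℕ → Matrix (Fin ny) (Fin nu) ℝ) (Y : ℤ → Fin ny → ℝ) (U : ℤ → Fin nu → ℝ)
    (t : ℤ) (i : Fin ny) (θ : ℝ) (s : ℤ) :
    arxRes na nb ny nu A B (Function.update Y t (Function.update (Y t) i θ)) U s =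
      arxRes na nb ny nu A B Y U s + (θ - Y t i) • arxResDir na ny A t i s := by
  have hcol : ∀ k : ℕ, A k *ᵥ (if s - k = t then Pi.single i (1 : ℝ) else 0) =
      if s - k = t then (A k).col i else 0 := by
    intro k
    split_ifs <;> simp
  simp only [arxRes, arxResDir, update_update_apply_eq_add, mulVec_add, mulVec_smul, hcol,
    Finset.sum_add_distrib, ← Finset.smul_sum, smul_sub]
  abel

theorem arxResDir_self (na ny : ℕ) (A : ℕ → Matrix (Fin ny) (Fin ny) ℝ) (t : ℤ) (i : Fin ny) :
    arxResDir na ny A t i t = -Pi.single i 1 := by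
  rw [arxResDir, Finset.sum_eq_zero]
  · simp
  · intro k hk
    rw [Finset.mem_Icc] at hk
    exact if_neg (by omega)

theorem arxResDir_add (na ny : ℕ) (A : ℕ → Matrix (Fin ny) (Fin ny) ℝ) (t : ℤ) (i : Fin ny)
    {n : ℕ} (hn : n ∈ Finset.Icc 1 na) :
    arxResDir na ny A t i (t + n) = (A n).col i := by
  have hn' := Finset.mem_Icc.mp hn
  rw [arxResDir, Finset.sum_eq_single_of_mem n hn, if_pos (by omega), if_neg (by omega), sub_zero]
  intro k _ hk
  exact if_neg (by omega)

theorem arxResDir_eq_zero (na ny : ℕ) (A : ℕ → Matrix (Fin ny) (Fin ny) ℝ) {t : ℤ} (i : Fin ny)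
    {s : ℤ} (hst : s ≠ t) (hs : ∀ n ∈ Finset.Icc 1 na, s ≠ t + (n : ℕ)) :
    arxResDir na ny A t i s = 0 := by
  rw [arxResDir, if_neg hst, Finset.sum_eq_zero, sub_zero]
  intro k hk
  exact if_neg fun h => hs k hk (by omega)

/-- Summing a function of the residual directions over the horizon. -/
theorem sum_arxResDir (T na ny : ℕ) (A : ℕ → Matrix (Fin ny) (Fin ny) ℝ) {t : ℤ}
    (ht1 : 1 ≤ t) (htT : t ≤ T) (i : Fin ny) (F : ℤ → (Fin ny → ℝ) → ℝ) (hF : ∀ s, F s 0 = 0) :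
    ∑ s ∈ Finset.Icc (1 : ℤ) T, F s (arxResDir na ny A t i s) =
      F t (-Pi.single i 1) +
        ∑ n ∈ Finset.Icc 1 (min na ((T : ℤ) - t).toNat), F (t + n) ((A n).col i) := by
  rw [sum_horizon_eq T na ht1 htT _ fun s hst hs => by
    rw [arxResDir_eq_zero na ny A i hst hs, hF], arxResDir_self]
  congr 1
  refine Finset.sum_congr rfl fun n hn => ?_
  rw [arxResDir_add]
  simp only [Finset.mem_Icc] at hn ⊢
  omega

theorem dotProduct_mulVec_add_smul_single {ny : ℕ} {W : Matrix (Fin ny) (Fin ny) ℝ}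
    (hW : W.IsDiag) (x : Fin ny → ℝ) (i : Fin ny) (δ : ℝ) :
    (x + δ • Pi.single i 1) ⬝ᵥ (W *ᵥ (x + δ • Pi.single i 1)) =
      x ⬝ᵥ (W *ᵥ x) + 2 * W i i * x i * δ + W i i * δ ^ 2 := by
  have hx : x ⬝ᵥ W.col i = x i * W i i := by
    rw [dotProduct, Finset.sum_eq_single_of_mem i (Finset.mem_univ i)]
    · rfl
    · intro k _ hk
      simp [hW hk]
  have hWx : (W *ᵥ x) i = W i i * x i := by
    rw [mulVec, dotProduct, Finset.sum_eq_single_of_mem i (Finset.mem_univ i)]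
    intro k _ hk
    simp [hW hk.symm]
  simp only [mulVec_add, mulVec_smul, mulVec_single_one, add_dotProduct, dotProduct_add,
    smul_dotProduct, dotProduct_smul, single_one_dotProduct, smul_eq_mul, hx, hWx, col_apply]
  ring

/-- The augmented Lagrangian is quadratic along one output coordinate. -/
theorem augLag_update_output (T na nb ny nu : ℕ)
    (A : ℕ → Matrix (Fin ny) (Fin ny) ℝ) (B : ℕ → Matrix (Fin ny) (Fin nu) ℝ)
    (ρ : ℝ) {Wy : Matrix (Fin ny) (Fin ny) ℝ} (Wd : Matrix (Fin nu) (Fin nu) ℝ)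
    (hWy : Wy.IsDiag) (r lam : ℤ → Fin ny → ℝ) (gam : ℤ → Fin nu → ℝ)
    (Y : ℤ → Fin ny → ℝ) (U ΔU : ℤ → Fin nu → ℝ)
    {t : ℤ} (ht1 : 1 ≤ t) (htT : t ≤ T) (i : Fin ny) (θ : ℝ) :
    augLag T na nb ny nu A B ρ Wy Wd r lam gam
        (Function.update Y t (Function.update (Y t) i θ)) U ΔU =
      augLag T na nb ny nu A B ρ Wy Wd r lam gam Y U ΔU
        + (ρ⁻¹ * Wy i i * (Y t i - r t i) + ∑ s ∈ Finset.Icc (1 : ℤ) T,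
            (lam s + arxRes na nb ny nu A B Y U s) ⬝ᵥ arxResDir na ny A t i s) * (θ - Y t i)
        + (ρ⁻¹ * Wy i i + ∑ s ∈ Finset.Icc (1 : ℤ) T,
            arxResDir na ny A t i s ⬝ᵥ arxResDir na ny A t i s) / 2 * (θ - Y t i) ^ 2 := by
  obtain ⟨δ, hδ⟩ : ∃ δ, δ = θ - Y t i := ⟨_, rfl⟩
  have hcost : ∑ s ∈ Finset.Icc (1 : ℤ) T,
      ((Function.update Y t (Function.update (Y t) i θ) s - r s) ⬝ᵥ
          (Wy *ᵥ (Function.update Y t (Function.update (Y t) i θ) s - r s)) +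
        ΔU (s - 1) ⬝ᵥ (Wd *ᵥ ΔU (s - 1))) =
      ∑ s ∈ Finset.Icc (1 : ℤ) T,
        ((Y s - r s) ⬝ᵥ (Wy *ᵥ (Y s - r s)) + ΔU (s - 1) ⬝ᵥ (Wd *ᵥ ΔU (s - 1))) +
      (2 * Wy i i * (Y t i - r t i) * δ + Wy i i * δ ^ 2) := by
    rw [← sub_eq_iff_eq_add', ← Finset.sum_sub_distrib,
      Finset.sum_eq_single_of_mem t (Finset.mem_Icc.mpr ⟨ht1, htT⟩)]
    · rw [update_update_apply_eq_add, if_pos rfl, ← hδ,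
        add_sub_right_comm (Y t) (δ • Pi.single i 1) (r t), dotProduct_mulVec_add_smul_single hWy, Pi.sub_apply]
      ring
    · intro s _ hs
      rw [Function.update_of_ne hs, sub_self]
  simp only [augLag, hcost, arxRes_update, ← hδ]
  simp only [dotProduct_add, add_dotProduct, dotProduct_smul, smul_dotProduct, smul_eq_mul,
    Finset.sum_add_distrib, ← Finset.mul_sum,
    dotProduct_comm (arxResDir na ny A t i _) (arxRes na nb ny nu A B Y U _)]
  field_simp
  ring

/-- The single-coordinate update of Procedure 2 (Step 1.2), computed from the
residual-augmented multipliers `λ̃_s = λ_s + res_s(Y,U)`, is exactly the unique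
minimizer over `[y_{min,i}, y_{max,i}]` of the augmented Lagrangian along the
coordinate `y_{t,i}`. -/
theorem augLag_output_coordinate_minimizer (T na nb ny nu : ℕ)
    (hT : 1 ≤ T) (hna : 1 ≤ na) (hnb : 1 ≤ nb) (hny : 1 ≤ ny) (hnu : 1 ≤ nu)
    (A : ℕ → Matrix (Fin ny) (Fin ny) ℝ) (B : ℕ → Matrix (Fin ny) (Fin nu) ℝ)
    (ρ : ℝ) (hρ : 0 < ρ)
    (Wy : Matrix (Fin ny) (Fin ny) ℝ) (Wd : Matrix (Fin nu) (Fin nu) ℝ)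
    (hWy : Wy.IsDiag) (hWy0 : ∀ i, 0 ≤ Wy i i) (hWd : Wd.IsDiag)
    (ymin ymax : Fin ny → ℝ) (hy : ymin ≤ ymax)
    (r lam : ℤ → Fin ny → ℝ) (gam : ℤ → Fin nu → ℝ)
    (Y : ℤ → Fin ny → ℝ) (U ΔU : ℤ → Fin nu → ℝ)
    (t : ℤ) (ht1 : 1 ≤ t) (htT : t ≤ T) (i : Fin ny) :
    let j : ℕ := min na ((T : ℤ) - t).toNat
    let H : Matrix (Fin ny) (Fin ny) ℝ :=
      ρ⁻¹ • Wy + 1 + ∑ n ∈ Finset.Icc 1 j, (A n)ᵀ * A n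
    let lamTilde : ℤ → Fin ny → ℝ := fun s => lam s + arxRes na nb ny nu A B Y U s
    let g : ℝ → ℝ := fun θ =>
      augLag T na nb ny nu A B ρ Wy Wd r lam gam
        (Function.update Y t (Function.update (Y t) i θ)) U ΔU
    let θstar : ℝ :=
      max (ymin i) (min (ymax i)
        (Y t i -
          (ρ⁻¹ * Wy i i * (Y t i - r t i) - lamTilde t i
            + ∑ n ∈ Finset.Icc 1 j, ((A n)ᵀ *ᵥ lamTilde (t + n)) i) / H i i))
    θstar ∈ Set.Icc (ymin i) (ymax i) ∧
      (∀ θ ∈ Set.Icc (ymin i) (ymax i), g θstar ≤ g θ) ∧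
      (∀ θ ∈ Set.Icc (ymin i) (ymax i),
        (∀ η ∈ Set.Icc (ymin i) (ymax i), g θ ≤ g η) → θ = θstar) := by
  intro j H lamTilde g θstar
  have hcol : ∀ (M : Matrix (Fin ny) (Fin ny) ℝ) (x : Fin ny → ℝ), x ⬝ᵥ M.col i = (Mᵀ *ᵥ x) i :=
    fun M x => dotProduct_comm _ _
  have hlin := sum_arxResDir T na ny A ht1 htT i (fun s v => lamTilde s ⬝ᵥ v) (by simp)
  have hquad := sum_arxResDir T na ny A ht1 htT i (fun _ v => v ⬝ᵥ v) (by simp)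
  have hH : H i i = ρ⁻¹ * Wy i i + ∑ s ∈ Finset.Icc (1 : ℤ) T,
      arxResDir na ny A t i s ⬝ᵥ arxResDir na ny A t i s := by
    rw [hquad]
    simp [H, j, Matrix.sum_apply, mul_apply, dotProduct, add_assoc, Pi.single_apply]
  have hHpos : 0 < H i i := by
    have h1 : 0 ≤ ρ⁻¹ * Wy i i := mul_nonneg (inv_nonneg.mpr hρ.le) (hWy0 i)
    have h2 : 0 ≤ ∑ n ∈ Finset.Icc 1 (min na ((T : ℤ) - t).toNat), (A n).col i ⬝ᵥ (A n).col i :=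
      Finset.sum_nonneg fun n _ => Finset.sum_nonneg fun k _ => mul_self_nonneg _
    have h3 : (-Pi.single i 1 : Fin ny → ℝ) ⬝ᵥ -Pi.single i 1 = 1 := by simp
    rw [hH, hquad, h3]
    linarith
  refine clip_isUniqueMin_quadratic (hy i) hHpos
    (c₀ := augLag T na nb ny nu A B ρ Wy Wd r lam gam Y U ΔU) fun θ => ?_
  have hgrad : ρ⁻¹ * Wy i i * (Y t i - r t i) - lamTilde t i
      + ∑ n ∈ Finset.Icc 1 j, ((A n)ᵀ *ᵥ lamTilde (t + n)) i =
      ρ⁻¹ * Wy i i * (Y t i - r t i) + ∑ s ∈ Finset.Icc (1 : ℤ) T,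
        lamTilde s ⬝ᵥ arxResDir na ny A t i s := by
    rw [hlin]
    simp only [hcol, dotProduct_neg, dotProduct_single_one, j]
    ring
  rw [hH, hgrad]
  exact augLag_update_output T na nb ny nu A B ρ Wd hWy r lam gam Y U ΔU ht1 htT i θ
end
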